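/- arXiv:1702.03877 — 2 statements merged into one kernel-verified Lean document; each statement's English description precedes it below -/
import Mathlib

section
/- (Random Fourier feature representation of a shift-invariant kernel, Proposition 3.) Let μ be a Borel probability measure on ℝ^p and define k : ℝ^p × ℝ^p → ℝ by k(x, y) = ∫_{ℝ^p} cos(⟨w, x − y⟩) dμ(w). Let W be a random vector with distribution μ and let B be uniformly distributed on [0, 2π], with W and B independent. Then for all x, y ∈ ℝ^p, k(x, y) = E[ζ(x) ζ(y)], where ζ(x) = √2 · cos(⟨W, x⟩ + B). -/
open MeasureTheory ProbabilityTheory Real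

/-- The product of two cosines with a common uniformly distributed phase shift averages to half the
cosine of the difference of their phases. -/
theorem integral_two_mul_cos_add_mul_cos_add (a c : ℝ) :
    ∫ b in (0 : ℝ)..(2 * π), 2 * (cos (a + b) * cos (c + b)) = 2 * π * cos (a - c) := by
  have product_to_sum (b : ℝ) :
      2 * (cos (a + b) * cos (c + b)) = cos (a - c) + cos (2 * b + (a + c)) := by
    rw [← mul_assoc, two_mul_cos_mul_cos]
    ring_nf
  have integral_shift : ∫ b in (0 : ℝ)..(2 * π), cos (2 * b + (a + c)) = 0 := by
    rw [intervalIntegral.integral_comp_mul_add cos two_ne_zero, integral_cos,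
      show 2 * (2 * π) + (a + c) = (a + c) + (2 : ℕ) * (2 * π) by push_cast; ring,
      sin_add_nat_mul_two_pi]
    simp
  simp_rw [product_to_sum]
  rw [intervalIntegral.integral_add (by simp)
    (Continuous.intervalIntegrable (by fun_prop) _ _), integral_shift]
  simp

/-- The uniform distribution on `[0, 2π]` is a probability measure. -/
theorem isProbabilityMeasure_uniform_Icc_two_pi :
    IsProbabilityMeasure ((ENNReal.ofReal (2 * π))⁻¹ •
      (volume : Measure ℝ).restrict (Set.Icc (0 : ℝ) (2 * π))) := by
  constructor
  have ofReal_two_pi_pos : 0 < ENNReal.ofReal (2 * π) := ENNReal.ofReal_pos.2 two_pi_pos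
  simpa using ENNReal.inv_mul_cancel ofReal_two_pi_pos.ne' ENNReal.ofReal_ne_top

/-- The expectation of a product of two random cosine features over the uniform phase. -/
theorem integral_cos_feature_mul_cos_feature (a c : ℝ) :
    ∫ b, (√2 * cos (a + b)) * (√2 * cos (c + b)) ∂((ENNReal.ofReal (2 * π))⁻¹ •
      (volume : Measure ℝ).restrict (Set.Icc (0 : ℝ) (2 * π))) = cos (a - c) := by
  have feature_mul (b : ℝ) :
      (√2 * cos (a + b)) * (√2 * cos (c + b)) = 2 * (cos (a + b) * cos (c + b)) := by
    rw [mul_mul_mul_comm, mul_self_sqrt zero_le_two]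
  simp_rw [feature_mul]
  rw [integral_smul_measure, integral_Icc_eq_integral_Ioc,
    ← intervalIntegral.integral_of_le two_pi_pos.le, integral_two_mul_cos_add_mul_cos_add,
    ENNReal.toReal_inv, ENNReal.toReal_ofReal two_pi_pos.le, smul_eq_mul,
    inv_mul_cancel_left₀ two_pi_pos.ne']

/-- random Fourier feature representation, Proposition 3: if
`k x y = ∫ w, cos ⟨w, x − y⟩ ∂μ` for a Borel probability measure `μ` on `ℝ^p`, then for all
`x, y`, `k x y = E[ζ x * ζ y]` where `ζ x = √2 cos (⟨W, x⟩ + B)`, `W ~ μ`, `B` uniform on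
`[0, 2π]`, and `W, B` independent (expectation over the product measure). -/
theorem rff_kernel_eq_expectation_cos
    (p : ℕ) (μ : Measure (Fin p → ℝ)) [IsProbabilityMeasure μ]
    (k : (Fin p → ℝ) → (Fin p → ℝ) → ℝ)
    (hk : ∀ x y, k x y = ∫ w, Real.cos (∑ i, w i * (x i - y i)) ∂μ) :
    ∀ x y, k x y =
      ∫ wb : (Fin p → ℝ) × ℝ,
        (Real.sqrt 2 * Real.cos ((∑ i, wb.1 i * x i) + wb.2)) *
          (Real.sqrt 2 * Real.cos ((∑ i, wb.1 i * y i) + wb.2))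
        ∂(μ.prod
            ((ENNReal.ofReal (2 * Real.pi))⁻¹ •
              volume.restrict (Set.Icc (0 : ℝ) (2 * Real.pi)))) := by
  intro x y
  have := isProbabilityMeasure_uniform_Icc_two_pi
  rw [hk, integral_prod]
  · refine integral_congr_ae (.of_forall fun w => ?_)
    simp only [integral_cos_feature_mul_cos_feature, mul_sub, Finset.sum_sub_distrib]
  · refine Integrable.of_bound (Continuous.aestronglyMeasurable (by fun_prop)) (√2 * √2)
      (.of_forall fun wb => ?_)
    have abs_feature_le (t : ℝ) : |√2 * cos t| ≤ √2 := by
      rw [abs_mul, abs_of_nonneg (sqrt_nonneg 2)]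
      exact mul_le_of_le_one_right (sqrt_nonneg 2) (abs_cos_le_one t)
    rw [norm_eq_abs, abs_mul]
    gcongr <;> exact abs_feature_le _
end

section
/- There exist {0,1}-valued random variables X, Y, Z on a finite probability space such that X and Y are NOT conditionally independent given Z, and yet for all x, y ∈ {0,1}: P(X = x, Y = y) = Σ_{z ∈ {0,1}} P(Z = z) P(X = x | Z = z) P(Y = y | Z = z). Concretely, the joint distribution determined by P(Z=0)=0.2, P(Z=1)=0.8; P(X=0|Z=0)=0.5, P(X=0|Z=1)=0.3; P(Y=0|Z=0)=0.3, P(Y=0|Z=1)=0.4; and P(X=0,Y=0|Z=0)=0.2, P(X=0,Y=1|Z=0)=0.3, P(X=1,Y=0|Z=0)=0.1, P(X=1,Y=1|Z=0)=0.4, P(X=0,Y=0|Z=1)=0.1075, P(X=0,Y=1|Z=1)=0.1925, P(X=1,Y=0|Z=1)=0.2925, P(X=1,Y=1|Z=1)=0.4075, satisfies these properties (in particular P(X=0,Y=0)=0.126, P(X=0,Y=1)=0.214, P(X=1,Y=0)=0.254, P(X=1,Y=1)=0.406). -/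
open MeasureTheory ProbabilityTheory Finset

/-- Numbers of outcomes, out of 1000, of each triple `(x, y, z)`. -/
def tripleWeight (ω : Fin 2 × Fin 2 × Fin 2) : ℕ :=
  ![![![40, 86], ![60, 154]], ![![20, 234], ![80, 326]]] ω.1 ω.2.1 ω.2.2

/-- The law of `(X, Y, Z)` on `{0,1}³`, with atoms proportional to `tripleWeight`. -/
noncomputable def tripleLaw : Measure (Fin 2 × Fin 2 × Fin 2) :=
  ∑ ω, ((tripleWeight ω : ENNReal) / 1000) • Measure.dirac ω

theorem tripleLaw_setOf (p : Fin 2 × Fin 2 × Fin 2 → Prop) [DecidablePred p] :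
    tripleLaw {ω | p ω} = ((∑ ω with p ω, tripleWeight ω : ℕ) : ENNReal) / 1000 := by
  simp only [tripleLaw, Measure.coe_finsetSum, Finset.sum_apply, Measure.smul_apply,
    Measure.dirac_apply, smul_eq_mul, Nat.cast_sum, div_eq_mul_inv, Finset.sum_mul,
    Finset.sum_filter]
  exact Finset.sum_congr rfl fun ω _ ↦ by by_cases h : p ω <;> simp [h]

theorem tripleLaw_cond_setOf (p q : Fin 2 × Fin 2 × Fin 2 → Prop) [DecidablePred p]
    [DecidablePred q] :
    tripleLaw[{ω | p ω} | {ω | q ω}] =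
      ((∑ ω with q ω ∧ p ω, tripleWeight ω : ℕ) : ENNReal) /
        (∑ ω with q ω, tripleWeight ω : ℕ) := by
  rw [cond_apply (Set.toFinite _).measurableSet, ← Set.ofPred_and, tripleLaw_setOf,
    tripleLaw_setOf, mul_comm, ← div_eq_mul_inv, div_eq_mul_inv _ (1000 : ENNReal),
    div_eq_mul_inv _ (1000 : ENNReal), ENNReal.mul_div_mul_right _ _ (by simp) (by simp)]

instance : IsProbabilityMeasure tripleLaw where
  measure_univ := by
    have h := tripleLaw_setOf fun _ ↦ True
    rw [show (∑ ω with True, tripleWeight ω) = 1000 by decide +kernel] at h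
    simpa [ENNReal.div_self] using h

theorem ENNReal.natCast_div_eq_natCast_div {a b c d : ℕ} (hb : b ≠ 0) (hd : d ≠ 0)
    (h : a * d = c * b) : (a : ENNReal) / b = c / d := by
  rw [ENNReal.div_eq_div_iff (by simpa using hd) (by simp) (by simpa using hb) (by simp)]
  exact_mod_cast (by linarith : d * a = b * c)

theorem tripleLaw_setOf_eq (p : Fin 2 × Fin 2 × Fin 2 → Prop) [DecidablePred p] {c d : ℕ}
    {r s : ENNReal} (hr : (c : ENNReal) = r) (hs : (d : ENNReal) = s) (hd : d ≠ 0)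
    (h : (∑ ω with p ω, tripleWeight ω) * d = c * 1000) :
    tripleLaw {ω | p ω} = r / s := by
  rw [tripleLaw_setOf, ← hr, ← hs]
  exact_mod_cast ENNReal.natCast_div_eq_natCast_div (by norm_num) hd h

theorem tripleLaw_cond_setOf_eq (p q : Fin 2 × Fin 2 × Fin 2 → Prop) [DecidablePred p]
    [DecidablePred q] {c d : ℕ} {r s : ENNReal} (hr : (c : ENNReal) = r)
    (hs : (d : ENNReal) = s) (hq : (∑ ω with q ω, tripleWeight ω) ≠ 0) (hd : d ≠ 0)
    (h : (∑ ω with q ω ∧ p ω, tripleWeight ω) * d = c * ∑ ω with q ω, tripleWeight ω) :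
    tripleLaw[{ω | p ω} | {ω | q ω}] = r / s := by
  rw [tripleLaw_cond_setOf, ← hr, ← hs]
  exact ENNReal.natCast_div_eq_natCast_div hq hd h

/-- There exist `{0,1}`-valued random variables `X, Y, Z` on a finite probability
space (with all sets measurable) such that `X` and `Y` are NOT conditionally independent given
`Z`, and yet the joint law of `(X, Y)` is the `Z`-mixture of the products of the conditional
laws: `P(X = x, Y = y) = ∑ z, P(Z = z) P(X = x | Z = z) P(Y = y | Z = z)`; concretely, the
joint distribution with `P(Z=0) = 0.2`, `P(X=0|Z=0) = 0.5`, `P(X=0|Z=1) = 0.3`,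
`P(Y=0|Z=0) = 0.3`, `P(Y=0|Z=1) = 0.4`, conditional joints `(0.2, 0.3, 0.1, 0.4)` given `Z=0`
and `(0.1075, 0.1925, 0.2925, 0.4075)` given `Z=1`, and marginal joint
`(0.126, 0.214, 0.254, 0.406)`, has these properties. -/
theorem exists_not_condIndep_with_mixture_factorization :
    ∃ (Ω : Type) (_ : Fintype Ω) (_ : MeasurableSpace Ω) (P : Measure Ω)
      (_ : IsProbabilityMeasure P) (X Y Z : Ω → Fin 2),
      (∀ s : Set Ω, MeasurableSet s) ∧
      -- X and Y are NOT conditionally independent given Z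
      (¬ ∀ (x y z : Fin 2), P {ω | Z ω = z} ≠ 0 →
          P[{ω | X ω = x ∧ Y ω = y} | {ω | Z ω = z}] =
            P[{ω | X ω = x} | {ω | Z ω = z}] * P[{ω | Y ω = y} | {ω | Z ω = z}]) ∧
      -- yet the joint law of (X, Y) is the mixture over z of products of conditional laws
      (∀ x y : Fin 2, P {ω | X ω = x ∧ Y ω = y} =
          ∑ z : Fin 2, P {ω | Z ω = z} *
            (P[{ω | X ω = x} | {ω | Z ω = z}] * P[{ω | Y ω = y} | {ω | Z ω = z}])) ∧
      -- the concrete distribution from the paper's Table 1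
      P {ω | Z ω = 0} = 2 / 10 ∧ P {ω | Z ω = 1} = 8 / 10 ∧
      P[{ω | X ω = 0} | {ω | Z ω = 0}] = 5 / 10 ∧
      P[{ω | X ω = 0} | {ω | Z ω = 1}] = 3 / 10 ∧
      P[{ω | Y ω = 0} | {ω | Z ω = 0}] = 3 / 10 ∧
      P[{ω | Y ω = 0} | {ω | Z ω = 1}] = 4 / 10 ∧
      P[{ω | X ω = 0 ∧ Y ω = 0} | {ω | Z ω = 0}] = 2 / 10 ∧
      P[{ω | X ω = 0 ∧ Y ω = 1} | {ω | Z ω = 0}] = 3 / 10 ∧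
      P[{ω | X ω = 1 ∧ Y ω = 0} | {ω | Z ω = 0}] = 1 / 10 ∧
      P[{ω | X ω = 1 ∧ Y ω = 1} | {ω | Z ω = 0}] = 4 / 10 ∧
      P[{ω | X ω = 0 ∧ Y ω = 0} | {ω | Z ω = 1}] = 43 / 400 ∧
      P[{ω | X ω = 0 ∧ Y ω = 1} | {ω | Z ω = 1}] = 77 / 400 ∧
      P[{ω | X ω = 1 ∧ Y ω = 0} | {ω | Z ω = 1}] = 117 / 400 ∧
      P[{ω | X ω = 1 ∧ Y ω = 1} | {ω | Z ω = 1}] = 163 / 400 ∧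
      P {ω | X ω = 0 ∧ Y ω = 0} = 63 / 500 ∧
      P {ω | X ω = 0 ∧ Y ω = 1} = 107 / 500 ∧
      P {ω | X ω = 1 ∧ Y ω = 0} = 127 / 500 ∧
      P {ω | X ω = 1 ∧ Y ω = 1} = 203 / 500 := by
  refine ⟨Fin 2 × Fin 2 × Fin 2, inferInstance, inferInstance, tripleLaw, inferInstance,
    fun ω ↦ ω.1, fun ω ↦ ω.2.1, fun ω ↦ ω.2.2, fun s ↦ s.toFinite.measurableSet,
    fun h ↦ ?_, fun x y ↦ ?_, ?_⟩
  · have hZ : tripleLaw {ω | ω.2.2 = 0} = 2 / 10 :=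
      tripleLaw_setOf_eq _ Nat.cast_ofNat Nat.cast_ofNat (by decide) (by decide +kernel)
    have hXY : tripleLaw[{ω | ω.1 = 0 ∧ ω.2.1 = 0} | {ω | ω.2.2 = 0}] = 2 / 10 :=
      tripleLaw_cond_setOf_eq _ _ Nat.cast_ofNat Nat.cast_ofNat (by decide +kernel)
        (by decide) (by decide +kernel)
    have hX : tripleLaw[{ω | ω.1 = 0} | {ω | ω.2.2 = 0}] = 5 / 10 :=
      tripleLaw_cond_setOf_eq _ _ Nat.cast_ofNat Nat.cast_ofNat (by decide +kernel)
        (by decide) (by decide +kernel)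
    have hY : tripleLaw[{ω | ω.2.1 = 0} | {ω | ω.2.2 = 0}] = 3 / 10 :=
      tripleLaw_cond_setOf_eq _ _ Nat.cast_ofNat Nat.cast_ofNat (by decide +kernel)
        (by decide) (by decide +kernel)
    have h₀ := h 0 0 0 (by rw [hZ]; simp [ENNReal.div_eq_zero_iff])
    rw [hXY, hX, hY] at h₀
    have h₁ := congrArg ENNReal.toReal h₀
    norm_num at h₁
  · have h : ∀ x y : Fin 2, (∑ ω with ω.1 = x ∧ ω.2.1 = y, tripleWeight ω) * 800 =
        (∑ ω with ω.2.2 = 0 ∧ ω.1 = x, tripleWeight ω) *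
            (∑ ω with ω.2.2 = 0 ∧ ω.2.1 = y, tripleWeight ω) * 4 +
          (∑ ω with ω.2.2 = 1 ∧ ω.1 = x, tripleWeight ω) *
            ∑ ω with ω.2.2 = 1 ∧ ω.2.1 = y, tripleWeight ω := by decide +kernel
    have h₀ : (∑ ω with ω.2.2 = 0, tripleWeight ω) = 200 := by decide +kernel
    have h₁ : (∑ ω with ω.2.2 = 1, tripleWeight ω) = 800 := by decide +kernel
    simp only [Fin.sum_univ_two, tripleLaw_setOf, tripleLaw_cond_setOf, h₀, h₁]
    have hxy := h x y
    generalize (∑ ω with ω.1 = x ∧ ω.2.1 = y, tripleWeight ω) = n at hxy ⊢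
    generalize (∑ ω with ω.2.2 = 0 ∧ ω.1 = x, tripleWeight ω) = a at hxy ⊢
    generalize (∑ ω with ω.2.2 = 0 ∧ ω.2.1 = y, tripleWeight ω) = b at hxy ⊢
    generalize (∑ ω with ω.2.2 = 1 ∧ ω.1 = x, tripleWeight ω) = c at hxy ⊢
    generalize (∑ ω with ω.2.2 = 1 ∧ ω.2.1 = y, tripleWeight ω) = d at hxy ⊢
    have hR : (n : ℝ) * 800 = a * b * 4 + c * d := by exact_mod_cast hxy
    have hfin (k l : ℕ) (hl : l ≠ 0) : (k : ENNReal) / l ≠ ⊤ :=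
      ENNReal.div_ne_top (by simp) (by simpa using hl)
    have h1000 (k : ℕ) : (k : ENNReal) / 1000 ≠ ⊤ := hfin k 1000 (by decide)
    have hz (k l m j : ℕ) (hj : j ≠ 0) :
        (k : ENNReal) / 1000 * (l / j * (m / j)) ≠ ⊤ :=
      ENNReal.mul_ne_top (h1000 k) (ENNReal.mul_ne_top (hfin l j hj) (hfin m j hj))
    have hz₀ := hz 200 a b 200 (by decide)
    have hz₁ := hz 800 c d 800 (by decide)
    rw [← ENNReal.toReal_eq_toReal_iff' (h1000 n) (ENNReal.add_ne_top.2 ⟨hz₀, hz₁⟩),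
      ENNReal.toReal_add hz₀ hz₁]
    simp only [ENNReal.toReal_mul, ENNReal.toReal_div, ENNReal.toReal_natCast,
      ENNReal.toReal_ofNat]
    push_cast
    linarith
  · refine ⟨?_, ?_, ?_, ?_, ?_, ?_, ?_, ?_, ?_, ?_, ?_, ?_, ?_, ?_, ?_, ?_, ?_, ?_⟩
    all_goals first
      | exact tripleLaw_setOf_eq _ Nat.cast_ofNat Nat.cast_ofNat (by decide) (by decide +kernel)
      | exact tripleLaw_cond_setOf_eq _ _ Nat.cast_ofNat Nat.cast_ofNat (by decide +kernel)
          (by decide) (by decide +kernel)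
      | exact tripleLaw_cond_setOf_eq _ _ Nat.cast_one Nat.cast_ofNat (by decide +kernel)
          (by decide) (by decide +kernel)
end
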